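/- Let π be a prior on the bomb-and-prize configurations and B a bit channel with Shannon capacity C(B). For every classical strategy using B assisted by shared randomness, with induced conditional distribution p(y|b,x), the average probability of opening the box with the bomb satisfies Σ_{b,x} π(b,x) p(b|b,x) ≥ (min_{b∈{1,2,3,4}} π^bomb(b)) · (1 − C(B))^{ln 4} / 4, where ln 4 is the natural logarithm of 4. -/

import Mathlib

/-- Binary entropy (base 2), with the convention `0 * log 0 = 0`
(automatic since `Real.logb 2 0 = 0`). -/
noncomputable def H2 (t : ℝ) : ℝ :=
  -(t * Real.logb 2 t) - (1 - t) * Real.logb 2 (1 - t)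

/-- Mutual information of a bit channel with `p = p_B(0|1)`, `q = p_B(1|0)`
and input prior `(s, 1 - s)`. -/
noncomputable def mutualInfo (p q s : ℝ) : ℝ :=
  H2 (s * q + (1 - s) * (1 - p)) - s * H2 q - (1 - s) * H2 p

/-- Shannon capacity of a bit channel with `p = p_B(0|1)`, `q = p_B(1|0)`. -/
noncomputable def capacity (p q : ℝ) : ℝ :=
  sSup {x | ∃ s ∈ Set.Icc (0 : ℝ) 1, x = mutualInfo p q s}

lemma H2_eq_binEntropy (t : ℝ) : H2 t = Real.binEntropy t / Real.log 2 := by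
  simp only [H2, Real.binEntropy, Real.logb, Real.log_inv]
  ring

lemma H2_nonneg {t : ℝ} (h0 : 0 ≤ t) (h1 : t ≤ 1) : 0 ≤ H2 t := by
  rw [H2_eq_binEntropy]
  exact div_nonneg (Real.binEntropy_nonneg h0 h1) (Real.log_nonneg one_le_two)

lemma H2_le_one (t : ℝ) : H2 t ≤ 1 := by
  rw [H2_eq_binEntropy]
  exact div_le_one_of_le₀ Real.binEntropy_le_log_two (Real.log_nonneg one_le_two)

lemma H2_one_sub (t : ℝ) : H2 (1 - t) = H2 t := by
  rw [H2_eq_binEntropy, H2_eq_binEntropy, Real.binEntropy_one_sub]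

lemma mutualInfo_one_sub (p q s : ℝ) : mutualInfo (1 - p) (1 - q) s = mutualInfo p q s := by
  have h : s * (1 - q) + (1 - s) * (1 - (1 - p)) = 1 - (s * q + (1 - s) * (1 - p)) := by ring
  rw [mutualInfo, h, H2_one_sub, H2_one_sub, H2_one_sub, mutualInfo]

lemma capacity_one_sub (p q : ℝ) : capacity (1 - p) (1 - q) = capacity p q := by
  simp only [capacity, mutualInfo_one_sub]

lemma mutualInfo_le_one {p q s : ℝ} (hp : p ∈ Set.Icc (0 : ℝ) 1) (hq : q ∈ Set.Icc (0 : ℝ) 1)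
    (hs : s ∈ Set.Icc (0 : ℝ) 1) : mutualInfo p q s ≤ 1 := by
  have h1 := mul_nonneg hs.1 (H2_nonneg hq.1 hq.2)
  have h2 := mul_nonneg (sub_nonneg.2 hs.2) (H2_nonneg hp.1 hp.2)
  have h3 := H2_le_one (s * q + (1 - s) * (1 - p))
  rw [mutualInfo]
  linarith

lemma capacity_le_one {p q : ℝ} (hp : p ∈ Set.Icc (0 : ℝ) 1) (hq : q ∈ Set.Icc (0 : ℝ) 1) :
    capacity p q ≤ 1 := by
  refine csSup_le ⟨_, 0, by simp, rfl⟩ ?_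
  rintro _ ⟨s, hs, rfl⟩
  exact mutualInfo_le_one hp hq hs

lemma mutualInfo_le_capacity {p q s : ℝ} (hp : p ∈ Set.Icc (0 : ℝ) 1)
    (hq : q ∈ Set.Icc (0 : ℝ) 1) (hs : s ∈ Set.Icc (0 : ℝ) 1) :
    mutualInfo p q s ≤ capacity p q := by
  refine le_csSup ⟨1, ?_⟩ ⟨s, hs, rfl⟩
  rintro _ ⟨s, hs, rfl⟩
  exact mutualInfo_le_one hp hq hs

lemma capacity_nonneg {p q : ℝ} (hp : p ∈ Set.Icc (0 : ℝ) 1) (hq : q ∈ Set.Icc (0 : ℝ) 1) :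
    0 ≤ capacity p q := by
  have h := mutualInfo_le_capacity hp hq (s := 0) (by simp)
  simpa [mutualInfo, H2_one_sub] using h

lemma two_mul_log_two_le_binEntropy {x : ℝ} (h0 : 0 ≤ x) (h1 : x ≤ 1 / 2) :
    2 * x * Real.log 2 ≤ Real.binEntropy x := by
  have h := Real.strictConcave_binEntropy.concaveOn.2 (show (0 : ℝ) ∈ Set.Icc 0 1 by simp)
    (show (2⁻¹ : ℝ) ∈ Set.Icc 0 1 by constructor <;> norm_num)
    (show 0 ≤ 1 - 2 * x by linarith) (show 0 ≤ 2 * x by linarith) (by ring)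
  simp only [smul_eq_mul, mul_zero, zero_add, Real.binEntropy_zero,
    Real.binEntropy_two_inv] at h
  rwa [show 2 * x * 2⁻¹ = x by ring] at h

lemma one_sub_abs_mul_log_two_le_binEntropy {u : ℝ} (h : |u| ≤ 1) :
    (1 - |u|) * Real.log 2 ≤ Real.binEntropy ((1 + u) / 2) := by
  rcases abs_cases u with ⟨hu, hs⟩ | ⟨hu, hs⟩ <;> rw [hu] at h ⊢
  · rw [← Real.binEntropy_one_sub]
    convert two_mul_log_two_le_binEntropy (x := 1 - (1 + u) / 2) (by linarith) (by linarith)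
      using 1
    ring
  · convert two_mul_log_two_le_binEntropy (x := (1 + u) / 2) (by linarith) (by linarith) using 1
    ring

lemma binEntropy_pow_four_div_eight_le {w : ℝ} (h0 : 0 ≤ w) (h1 : w ≤ 1) :
    Real.binEntropy (w ^ 4 / 8) ≤
      (w ^ 3 - w ^ 4) / 2 + 3 * Real.log 2 * w ^ 4 / 8 + w ^ 4 / 8 := by
  rcases h0.eq_or_lt with rfl | hw
  · simp
  have hw4 : w ^ 4 ≤ 1 := pow_le_one₀ h0 h1
  have hlog : Real.log (w ^ 4 / 8)⁻¹ = 4 * Real.log w⁻¹ + 3 * Real.log 2 := by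
    rw [Real.log_inv, Real.log_inv, Real.log_div (by positivity) (by norm_num), Real.log_pow,
      show (8 : ℝ) = 2 ^ 3 by norm_num, Real.log_pow]
    push_cast
    ring
  have hl1 := Real.log_le_sub_one_of_pos (inv_pos.2 hw)
  have hpos : 0 < 1 - w ^ 4 / 8 := by linarith
  have hl2 := mul_le_mul_of_nonneg_left
    (Real.log_le_sub_one_of_pos (inv_pos.2 hpos)) hpos.le
  rw [mul_sub, mul_inv_cancel₀ hpos.ne'] at hl2
  have hl3 := mul_le_mul_of_nonneg_left hl1 (show 0 ≤ w ^ 4 / 2 by positivity)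
  have hw3 : w ^ 4 / 2 * (w⁻¹ - 1) = (w ^ 3 - w ^ 4) / 2 := by field_simp
  rw [Real.binEntropy, hlog]
  linarith

lemma one_sub_mutualInfo_half_le {p q w : ℝ} (hp : 0 ≤ p) (hq : 0 ≤ q) (h0 : 0 ≤ w)
    (h1 : w ≤ 1) (hpq : p + q = w ^ 4 / 4) : 1 - mutualInfo p q (1 / 2) ≤ w ^ 3 := by
  have hw4 : w ^ 4 ≤ w ^ 3 := pow_le_pow_of_le_one h0 h1 (by norm_num)
  have hw1 : w ^ 4 ≤ 1 := pow_le_one₀ h0 h1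
  have hw40 : 0 ≤ w ^ 4 := by positivity
  have hu : |q - p| ≤ w ^ 4 / 4 := abs_le.2 ⟨by linarith, by linarith⟩
  have hL := Real.log_two_gt_d9
  have hA := one_sub_abs_mul_log_two_le_binEntropy (u := q - p) (by linarith)
  have hB := Real.strictConcave_binEntropy.concaveOn.2
    (show p ∈ Set.Icc 0 1 from ⟨hp, by linarith⟩) (show q ∈ Set.Icc 0 1 from ⟨hq, by linarith⟩)
    (show (0 : ℝ) ≤ 1 / 2 by norm_num) (show (0 : ℝ) ≤ 1 / 2 by norm_num) (by norm_num)
  simp only [smul_eq_mul] at hB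
  rw [show 1 / 2 * p + 1 / 2 * q = w ^ 4 / 8 by linarith] at hB
  have hC := binEntropy_pow_four_div_eight_le h0 h1
  have hD := mul_le_mul_of_nonneg_right hu (by linarith : 0 ≤ Real.log 2)
  have hE := mul_le_mul_of_nonneg_left Real.log_two_lt_d9.le hw40
  have hF := mul_le_mul_of_nonneg_left hL.le (by positivity : 0 ≤ w ^ 3)
  have key : Real.log 2 - Real.binEntropy ((1 + (q - p)) / 2) + (1 / 2 * Real.binEntropy q
      + 1 / 2 * Real.binEntropy p) ≤ w ^ 3 * Real.log 2 := by
    linarith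
  have hpos : 0 < Real.log 2 := by linarith
  rw [← div_le_iff₀ hpos] at key
  refine le_of_eq_of_le ?_ key
  rw [mutualInfo, H2_eq_binEntropy, H2_eq_binEntropy, H2_eq_binEntropy,
    show 1 / 2 * q + (1 - 1 / 2) * (1 - p) = (1 + (q - p)) / 2 by ring]
  field_simp
  ring

lemma one_sub_capacity_rpow_le {p q : ℝ} (hp : p ∈ Set.Icc (0 : ℝ) 1)
    (hq : q ∈ Set.Icc (0 : ℝ) 1) :
    (1 - capacity p q) ^ Real.log 4 / 4 ≤ p + q := by
  have hc0 := capacity_nonneg hp hq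
  have hc1 := capacity_le_one hp hq
  have hL : 4 / 3 ≤ Real.log 4 := by
    rw [show (4 : ℝ) = 2 ^ 2 by norm_num, Real.log_pow]
    have := Real.log_two_gt_d9
    push_cast
    linarith
  rcases le_total 1 (4 * (p + q)) with h | h
  · have := Real.rpow_le_one (sub_nonneg.2 hc1) (sub_le_self _ hc0) (by linarith : 0 ≤ Real.log 4)
    linarith
  have h0 : 0 ≤ 4 * (p + q) := by linarith [hp.1, hq.1]
  set w := (4 * (p + q)) ^ (1 / 4 : ℝ) with hw
  have hw0 : 0 ≤ w := Real.rpow_nonneg h0 _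
  have hw1 : w ≤ 1 := Real.rpow_le_one h0 h (by norm_num)
  have hw4 : w ^ 4 = 4 * (p + q) := by
    rw [hw, ← Real.rpow_mul_natCast h0]
    norm_num
  have hJ : 1 - capacity p q ≤ w ^ 3 :=
    (sub_le_sub_left (mutualInfo_le_capacity hp hq (by constructor <;> norm_num)) _).trans
      (one_sub_mutualInfo_half_le hp.1 hq.1 hw0 hw1 (by linarith))
  have hpow : (w ^ 3) ^ (4 / 3 : ℝ) = w ^ 4 := by
    rw [← Real.rpow_natCast_mul hw0, ← Real.rpow_natCast]
    norm_num
  have := calc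
    (1 - capacity p q) ^ Real.log 4 ≤ (w ^ 3) ^ Real.log 4 :=
      Real.rpow_le_rpow (sub_nonneg.2 hc1) hJ (by linarith)
    _ ≤ (w ^ 3) ^ (4 / 3 : ℝ) :=
      Real.rpow_le_rpow_of_exponent_ge' (by positivity) (pow_le_one₀ hw0 hw1) (by norm_num) hL
    _ = 4 * (p + q) := by rw [hpow, hw4]
  linarith

/-- For every prior `π` on bomb-and-prize configurations and every
classical strategy using a bit channel `B` assisted by shared randomness, the average
probability of opening the box with the bomb is at least
`(min_b π^bomb(b)) · (1 − C(B))^(ln 4) / 4`. -/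
theorem bomb_average_capacity_bound
    (π : Fin 4 → Fin 4 → ℝ)
    (hπnn : ∀ b x, 0 ≤ π b x)
    (hπsum : ∑ b, ∑ x, π b x = 1)
    (hπdiag : ∀ b, π b b = 0)
    (pB : Fin 2 → Fin 2 → ℝ)
    (hBnn : ∀ m' m, 0 ≤ pB m' m)
    (hBsum : ∀ m, ∑ m', pB m' m = 1)
    (n : ℕ) (lam : Fin n → ℝ)
    (hlamnn : ∀ i, 0 ≤ lam i) (hlamsum : ∑ i, lam i = 1)
    (penc : Fin n → Fin 4 → Fin 4 → Fin 2 → ℝ)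
    (hencnn : ∀ i b x m, x ≠ b → 0 ≤ penc i b x m)
    (hencsum : ∀ i b x, x ≠ b → ∑ m, penc i b x m = 1)
    (pdec : Fin n → Fin 2 → Fin 4 → ℝ)
    (hdecnn : ∀ i m' y, 0 ≤ pdec i m' y)
    (hdecsum : ∀ i m', ∑ y, pdec i m' y = 1)
    (p : Fin 4 → Fin 4 → Fin 4 → ℝ)
    (hp : ∀ y b x, x ≠ b →
      p y b x = ∑ i, lam i * ∑ m, ∑ m', pdec i m' y * pB m' m * penc i b x m) :
    (Finset.univ.inf' Finset.univ_nonempty fun b => ∑ x, π b x) *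
        ((1 - capacity (pB 0 1) (pB 1 0)) ^ Real.log 4 / 4)
      ≤ ∑ b, ∑ x, π b x * p b b x := by
  have hB0 := hBsum 0
  have hB1 := hBsum 1
  rw [Fin.sum_univ_two] at hB0 hB1
  have hp01 : pB 0 1 ∈ Set.Icc (0 : ℝ) 1 := ⟨hBnn _ _, by linarith [hBnn 1 1]⟩
  have hq10 : pB 1 0 ∈ Set.Icc (0 : ℝ) 1 := ⟨hBnn _ _, by linarith [hBnn 0 0]⟩
  set c := (1 - capacity (pB 0 1) (pB 1 0)) ^ Real.log 4 / 4 with hc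
  obtain ⟨μ, hμ0, hμ, hcμ⟩ : ∃ μ : Fin 2 → ℝ, (∀ m', 0 ≤ μ m') ∧
      (∀ m' m, μ m' ≤ pB m' m) ∧ c ≤ ∑ m', μ m' := by
    rcases le_total (pB 0 1 + pB 1 0) 1 with h | h
    · refine ⟨![pB 0 1, pB 1 0], ?_, ?_, ?_⟩
      · simp [Fin.forall_fin_two, hBnn]
      · simp only [Fin.forall_fin_two, Matrix.cons_val_zero, Matrix.cons_val_one]
        refine ⟨⟨?_, ?_⟩, ?_, ?_⟩ <;> linarith
      · simpa [Fin.sum_univ_two] using one_sub_capacity_rpow_le hp01 hq10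
    · refine ⟨![pB 0 0, pB 1 1], ?_, ?_, ?_⟩
      · simp [Fin.forall_fin_two, hBnn]
      · simp only [Fin.forall_fin_two, Matrix.cons_val_zero, Matrix.cons_val_one]
        refine ⟨⟨?_, ?_⟩, ?_, ?_⟩ <;> linarith
      · rw [hc, ← capacity_one_sub]
        refine (one_sub_capacity_rpow_le ⟨by linarith [hp01.2], by linarith [hp01.1]⟩
          ⟨by linarith [hq10.2], by linarith [hq10.1]⟩).trans ?_
        simp only [Fin.sum_univ_two, Matrix.cons_val_zero, Matrix.cons_val_one]
        linarith
  let D : Fin 4 → ℝ := fun b => ∑ i, lam i * ∑ m', pdec i m' b * μ m'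
  have hD0 : ∀ b, 0 ≤ D b := fun b => Finset.sum_nonneg fun i _ =>
    mul_nonneg (hlamnn i) (Finset.sum_nonneg fun m' _ => mul_nonneg (hdecnn i m' b) (hμ0 m'))
  have hDsum : ∑ b, D b = ∑ m', μ m' := by
    have h : ∀ i, ∑ b, ∑ m', pdec i m' b * μ m' = ∑ m', μ m' := fun i => by
      rw [Finset.sum_comm]
      simp only [← Finset.sum_mul, hdecsum, one_mul]
    simp only [D]
    rw [Finset.sum_comm]
    simp only [← Finset.mul_sum, h, ← Finset.sum_mul, hlamsum, one_mul]
  have hDp : ∀ b x, x ≠ b → D b ≤ p b b x := by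
    intro b x hx
    rw [hp b b x hx]
    refine Finset.sum_le_sum fun i _ => mul_le_mul_of_nonneg_left ?_ (hlamnn i)
    calc ∑ m', pdec i m' b * μ m'
        = ∑ m, (∑ m', pdec i m' b * μ m') * penc i b x m := by
          rw [← Finset.mul_sum, hencsum i b x hx, mul_one]
      _ ≤ _ := by
          refine Finset.sum_le_sum fun m _ => ?_
          rw [Finset.sum_mul]
          exact Finset.sum_le_sum fun m' _ => mul_le_mul_of_nonneg_right
            (mul_le_mul_of_nonneg_left (hμ m' m) (hdecnn i m' b)) (hencnn i b x m hx)
  set M := Finset.univ.inf' Finset.univ_nonempty fun b => ∑ x, π b x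
  have hM0 : 0 ≤ M := Finset.le_inf' _ _ fun b _ => Finset.sum_nonneg fun x _ => hπnn b x
  calc M * c ≤ M * ∑ b, D b := mul_le_mul_of_nonneg_left (hDsum ▸ hcμ) hM0
    _ = ∑ b, M * D b := Finset.mul_sum _ _ _
    _ ≤ ∑ b, (∑ x, π b x) * D b := Finset.sum_le_sum fun b hb =>
        mul_le_mul_of_nonneg_right (Finset.inf'_le _ hb) (hD0 b)
    _ ≤ ∑ b, ∑ x, π b x * p b b x := by
        refine Finset.sum_le_sum fun b _ => ?_
        rw [Finset.sum_mul]
        refine Finset.sum_le_sum fun x _ => ?_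
        rcases eq_or_ne x b with rfl | hx
        · simp [hπdiag]
        · exact mul_le_mul_of_nonneg_left (hDp b x hx) (hπnn b x)
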